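/- Let G be a connected finite simple graph with a vertex v of degree at least 2, and let W_1 ∪ W_2 be a non-trivial bipartition of the set of vertices adjacent to v (both W_1 and W_2 are non-empty). Let the graph G' be formed by taking G with v deleted and adding two new non-adjacent vertices v_1 and v_2, where v_i is adjacent to all of the vertices in W_i (for i = 1, 2). Then the spectral radius of the adjacency matrix of G' is strictly less than the spectral radius of the adjacency matrix of G. -/

import Mathlib

open SimpleGraph

-- The adjacency matrix of a simple graph over `ℝ` (using classical decidability).
open Classical in
noncomputable def adjMat {V : Type*} (G : SimpleGraph V) : Matrix V V ℝ :=
  Matrix.of fun i j => if G.Adj i j then 1 else 0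

/-- The spectral radius of a finite simple graph: the largest eigenvalue of its
adjacency matrix. -/
noncomputable def graphSpectralRadius {V : Type*} [Fintype V] [DecidableEq V]
    (G : SimpleGraph V) : ℝ :=
  sSup {μ : ℝ | Module.End.HasEigenvalue (Matrix.toLin' (adjMat G)) μ}

/-- The degree of a vertex: the number of its neighbours. -/
noncomputable def deg {V : Type*} (G : SimpleGraph V) (v : V) : ℕ :=
  (G.neighborSet v).ncard

/-- The star `K_{1,m}` on `m + 1` vertices: the centre `0` is adjacent to each of
the `m` pendant vertices. -/
def starGraph (m : ℕ) : SimpleGraph (Fin (m + 1)) :=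
  SimpleGraph.fromRel fun a b => a = 0 ∧ b ≠ 0


/-- The graph obtained from `G` by splitting the vertex `v` into two new
non-adjacent vertices `Sum.inr 0` and `Sum.inr 1`: the vertex `v` is deleted,
`Sum.inr 0` is joined to every vertex of `W₁` and `Sum.inr 1` is joined to
every vertex of `W₂`, with no edge between the two new vertices. -/
def splitVertex {V : Type*} [DecidableEq V] (G : SimpleGraph V) (v : V) (W₁ W₂ : Set V) :
    SimpleGraph ({w : V // w ≠ v} ⊕ Fin 2) :=
  SimpleGraph.fromRel fun p q =>
    (∃ a b : {w : V // w ≠ v}, p = Sum.inl a ∧ q = Sum.inl b ∧ G.Adj a.1 b.1) ∨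
    (∃ a : {w : V // w ≠ v}, p = Sum.inr 0 ∧ q = Sum.inl a ∧ a.1 ∈ W₁) ∨
    (∃ a : {w : V // w ≠ v}, p = Sum.inr 1 ∧ q = Sum.inl a ∧ a.1 ∈ W₂)

open Matrix

theorem adjMat_of_adj {V : Type*} {G : SimpleGraph V} {i j : V} (h : G.Adj i j) :
    adjMat G i j = 1 := by
  simp [adjMat, h]

theorem adjMat_of_not_adj {V : Type*} {G : SimpleGraph V} {i j : V} (h : ¬ G.Adj i j) :
    adjMat G i j = 0 := by
  simp [adjMat, h]

theorem adjMat_congr {U V : Type*} {H : SimpleGraph U} {G : SimpleGraph V} {i j : U} {k l : V}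
    (h : H.Adj i j ↔ G.Adj k l) : adjMat H i j = adjMat G k l := by
  by_cases hG : G.Adj k l
  · rw [adjMat_of_adj hG, adjMat_of_adj (h.mpr hG)]
  · rw [adjMat_of_not_adj hG, adjMat_of_not_adj (mt h.mp hG)]

theorem adjMat_symm_apply {V : Type*} (G : SimpleGraph V) (i j : V) :
    adjMat G i j = adjMat G j i :=
  adjMat_congr (G.adj_comm i j)

theorem isHermitian_adjMat {V : Type*} (G : SimpleGraph V) : (adjMat G).IsHermitian := by
  ext i j
  exact adjMat_symm_apply G j i

theorem adjMat_nonneg {V : Type*} (G : SimpleGraph V) (i j : V) : 0 ≤ adjMat G i j := by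
  simp only [adjMat, Matrix.of_apply]
  split_ifs <;> norm_num

theorem Matrix.hasEigenvalue_toLin'_iff {V : Type*} [Fintype V] [DecidableEq V]
    {A : Matrix V V ℝ} {μ : ℝ} :
    Module.End.HasEigenvalue (Matrix.toLin' A) μ ↔ ∃ x : V → ℝ, x ≠ 0 ∧ A *ᵥ x = μ • x := by
  constructor
  · intro h
    obtain ⟨x, hx⟩ := h.exists_hasEigenvector
    exact ⟨x, hx.2, by simpa using hx.apply_eq_smul⟩
  · rintro ⟨x, hx, h⟩
    exact Module.End.hasEigenvalue_of_hasEigenvector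
      ⟨Module.End.mem_eigenspace_iff.mpr (by simpa using h), hx⟩

theorem Matrix.finite_setOf_hasEigenvalue {V : Type*} [Fintype V] [DecidableEq V]
    (A : Matrix V V ℝ) : {μ : ℝ | Module.End.HasEigenvalue (Matrix.toLin' A) μ}.Finite :=
  Module.End.finite_hasEigenvalue _

theorem Matrix.IsHermitian.nonempty_setOf_hasEigenvalue {V : Type*} [Fintype V] [DecidableEq V]
    [Nonempty V] {A : Matrix V V ℝ} (hA : A.IsHermitian) :
    {μ : ℝ | Module.End.HasEigenvalue (Matrix.toLin' A) μ}.Nonempty := by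
  obtain ⟨i⟩ := ‹Nonempty V›
  refine ⟨hA.eigenvalues i, hasEigenvalue_toLin'_iff.mpr
    ⟨hA.eigenvectorBasis i, fun h => ?_, hA.mulVec_eigenvectorBasis i⟩⟩
  refine hA.eigenvectorBasis.orthonormal.ne_zero i ?_
  ext j
  exact congrFun h j

theorem Matrix.IsHermitian.posSemidef_smul_one_sub {V : Type*} [Fintype V] [DecidableEq V]
    {A : Matrix V V ℝ} (hA : A.IsHermitian) {c : ℝ}
    (hc : ∀ μ, Module.End.HasEigenvalue (Matrix.toLin' A) μ → μ ≤ c) :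
    (c • (1 : Matrix V V ℝ) - A).PosSemidef := by
  have hM : (c • (1 : Matrix V V ℝ) - A).IsHermitian := by
    refine Matrix.IsHermitian.sub ?_ hA
    ext i j
    simp [Matrix.one_apply, eq_comm]
  rw [hM.posSemidef_iff_eigenvalues_nonneg]
  intro i
  have h := hM.mulVec_eigenvectorBasis i
  rw [Matrix.sub_mulVec, Matrix.smul_mulVec, Matrix.one_mulVec, sub_eq_iff_eq_add,
    ← sub_eq_iff_eq_add', ← sub_smul] at h
  have := hc _ (hasEigenvalue_toLin'_iff.mpr
    ⟨hM.eigenvectorBasis i, fun h => ?_, h.symm⟩)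
  · simpa using this
  · refine hM.eigenvectorBasis.orthonormal.ne_zero i ?_
    ext j
    exact congrFun h j

theorem smul_abs_le_mulVec_abs {V : Type*} [Fintype V] {A : Matrix V V ℝ}
    (hA : ∀ i j, 0 ≤ A i j) {μ : ℝ} {x : V → ℝ} (h : A *ᵥ x = μ • x) (i : V) :
    μ * |x i| ≤ (A *ᵥ fun j => |x j|) i := by
  have hi : ∑ j, A i j * x j = μ * x i := congrFun h i
  calc μ * |x i| ≤ |μ * x i| := by
        rw [abs_mul]
        gcongr
        exact le_abs_self μ
    _ ≤ ∑ j, |A i j * x j| := hi ▸ Finset.abs_sum_le_sum_abs _ _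
    _ = ∑ j, A i j * |x j| := by
        refine Finset.sum_congr rfl fun j _ => ?_
        rw [abs_mul, abs_of_nonneg (hA i j)]

/-- A nonnegative eigenvector of a connected graph with a zero entry vanishes. -/
theorem SimpleGraph.Connected.eq_zero_of_adjMat_mulVec {V : Type*} [Fintype V]
    {G : SimpleGraph V} (hG : G.Connected) {c : ℝ} {y : V → ℝ} (hy : ∀ i, 0 ≤ y i)
    (h : adjMat G *ᵥ y = c • y) {u : V} (hu : y u = 0) : y = 0 := by
  funext w
  obtain ⟨p⟩ := hG.preconnected u w
  induction p with
  | nil => exact hu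
  | @cons a b _ hab _ ih =>
    refine ih ?_
    have ha : ∑ j, adjMat G a j * y j = 0 := by
      have := congrFun h a
      rw [Pi.smul_apply, hu, smul_zero] at this
      exact this
    rw [Finset.sum_eq_zero_iff_of_nonneg
      fun j _ => mul_nonneg (adjMat_nonneg G a j) (hy j)] at ha
    simpa [adjMat_of_adj hab] using ha b (Finset.mem_univ b)

/-- The Perron vector of a connected graph. -/
theorem SimpleGraph.Connected.exists_pos_adjMat_mulVec {V : Type*} [Fintype V] [DecidableEq V]
    {G : SimpleGraph V} (hG : G.Connected) :
    ∃ z : V → ℝ, (∀ i, 0 < z i) ∧ adjMat G *ᵥ z = graphSpectralRadius G • z := by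
  have := hG.nonempty
  have hA := isHermitian_adjMat G
  have hfin := finite_setOf_hasEigenvalue (adjMat G)
  obtain ⟨x, hx0, hx⟩ := hasEigenvalue_toLin'_iff.mp
    (hA.nonempty_setOf_hasEigenvalue.csSup_mem hfin)
  change adjMat G *ᵥ x = graphSpectralRadius G • x at hx
  have hpsd : (graphSpectralRadius G • (1 : Matrix V V ℝ) - adjMat G).PosSemidef :=
    hA.posSemidef_smul_one_sub fun μ hμ => le_csSup hfin.bddAbove hμ
  set y : V → ℝ := fun j => |x j| with hydef
  have hy : ∀ i, 0 ≤ y i := fun i => abs_nonneg _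
  have hMy : ∀ i, ((graphSpectralRadius G • (1 : Matrix V V ℝ) - adjMat G) *ᵥ y) i
      = graphSpectralRadius G * y i - (adjMat G *ᵥ y) i := fun i => by
    simp [Matrix.sub_mulVec, Matrix.smul_mulVec]
  have hform : star y ⬝ᵥ ((graphSpectralRadius G • (1 : Matrix V V ℝ) - adjMat G) *ᵥ y) = 0 := by
    refine le_antisymm (Finset.sum_nonpos fun i _ => ?_) (hpsd.dotProduct_mulVec_nonneg y)
    refine mul_nonpos_of_nonneg_of_nonpos (hy i) ?_
    rw [hMy]
    exact sub_nonpos.mpr (smul_abs_le_mulVec_abs (adjMat_nonneg G) hx i)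
  rw [hpsd.dotProduct_mulVec_zero_iff] at hform
  have heig : adjMat G *ᵥ y = graphSpectralRadius G • y := by
    funext i
    have := hMy i
    rw [hform] at this
    exact (sub_eq_zero.mp this.symm).symm
  refine ⟨y, fun i => (hy i).lt_of_ne fun hi => hx0 ?_, heig⟩
  have hy0 := hG.eq_zero_of_adjMat_mulVec hy heig hi.symm
  funext j
  exact abs_eq_zero.mp (congrFun hy0 j)

section splitVertex

variable {V : Type*} [DecidableEq V] {G : SimpleGraph V} {v : V} {W₁ W₂ : Set V}

theorem splitVertex_adj_inl_inl (a b : {w : V // w ≠ v}) :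
    (splitVertex G v W₁ W₂).Adj (Sum.inl a) (Sum.inl b) ↔ G.Adj a.1 b.1 := by
  simp only [splitVertex, SimpleGraph.fromRel_adj]
  have := G.adj_comm a.1 b.1
  have : G.Adj a.1 b.1 → a ≠ b := fun h hab => h.ne (congrArg _ hab)
  aesop

theorem splitVertex_adj_inl_zero (a : {w : V // w ≠ v}) :
    (splitVertex G v W₁ W₂).Adj (Sum.inl a) (Sum.inr 0) ↔ a.1 ∈ W₁ := by
  simp only [splitVertex, SimpleGraph.fromRel_adj]
  aesop

theorem splitVertex_adj_inl_one (a : {w : V // w ≠ v}) :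
    (splitVertex G v W₁ W₂).Adj (Sum.inl a) (Sum.inr 1) ↔ a.1 ∈ W₂ := by
  simp only [splitVertex, SimpleGraph.fromRel_adj]
  aesop

theorem splitVertex_not_adj_inr_inr (i j : Fin 2) :
    ¬ (splitVertex G v W₁ W₂).Adj (Sum.inr i) (Sum.inr j) := by
  simp [splitVertex]

/-- The projection identifying the two vertices created by splitting `v`. -/
def unsplit (v : V) : {w : V // w ≠ v} ⊕ Fin 2 → V :=
  Sum.elim Subtype.val fun _ => v

theorem adjMat_splitVertex_add (hW : W₁ ∪ W₂ = G.neighborSet v) (hdisj : Disjoint W₁ W₂)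
    (a : {w : V // w ≠ v}) :
    adjMat (splitVertex G v W₁ W₂) (Sum.inl a) (Sum.inr 0) +
      adjMat (splitVertex G v W₁ W₂) (Sum.inl a) (Sum.inr 1) = adjMat G a.1 v := by
  have hadj : G.Adj a.1 v ↔ a.1 ∈ W₁ ∨ a.1 ∈ W₂ := by
    rw [G.adj_comm, ← SimpleGraph.mem_neighborSet, ← hW, Set.mem_union]
  have hd : a.1 ∈ W₁ → a.1 ∉ W₂ := fun h h' => Set.disjoint_left.mp hdisj h h'
  have h0 := splitVertex_adj_inl_zero (G := G) (W₁ := W₁) (W₂ := W₂) a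
  have h1 := splitVertex_adj_inl_one (G := G) (W₁ := W₁) (W₂ := W₂) a
  by_cases h₁ : a.1 ∈ W₁
  · rw [adjMat_of_adj (h0.mpr h₁), adjMat_of_not_adj (mt h1.mp (hd h₁)),
      adjMat_of_adj (hadj.mpr (Or.inl h₁)), add_zero]
  · rw [adjMat_of_not_adj (mt h0.mp h₁), zero_add]
    exact adjMat_congr (h1.trans (hadj.trans (or_iff_right h₁)).symm)

variable [Fintype V]

theorem adjMat_splitVertex_mulVec_inl (hW : W₁ ∪ W₂ = G.neighborSet v)
    (hdisj : Disjoint W₁ W₂) (f : V → ℝ) (a : {w : V // w ≠ v}) :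
    (adjMat (splitVertex G v W₁ W₂) *ᵥ (f ∘ unsplit v)) (Sum.inl a) =
      (adjMat G *ᵥ f) a.1 := by
  simp only [Matrix.mulVec, dotProduct, Fintype.sum_sum_type, Fin.sum_univ_two]
  rw [Fintype.sum_eq_add_sum_subtype_ne _ v, ← adjMat_splitVertex_add hW hdisj a, add_comm,
    add_mul]
  congr 1
  refine Finset.sum_congr rfl fun b _ => ?_
  rw [adjMat_congr (splitVertex_adj_inl_inl a b)]
  rfl

theorem adjMat_splitVertex_mulVec_inr_add (hW : W₁ ∪ W₂ = G.neighborSet v)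
    (hdisj : Disjoint W₁ W₂) (f : V → ℝ) :
    (adjMat (splitVertex G v W₁ W₂) *ᵥ (f ∘ unsplit v)) (Sum.inr 0) +
      (adjMat (splitVertex G v W₁ W₂) *ᵥ (f ∘ unsplit v)) (Sum.inr 1) =
      (adjMat G *ᵥ f) v := by
  have h0 : ∀ i j : Fin 2,
      adjMat (splitVertex G v W₁ W₂) (Sum.inr i) (Sum.inr j) = 0 := fun i j =>
    adjMat_of_not_adj (splitVertex_not_adj_inr_inr i j)
  have hv : adjMat G v v = 0 := adjMat_of_not_adj (G.loopless.irrefl v)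
  simp only [Matrix.mulVec, dotProduct, Fintype.sum_sum_type, h0, zero_mul,
    Finset.sum_const_zero, add_zero]
  rw [Fintype.sum_eq_add_sum_subtype_ne _ v, hv, zero_mul, zero_add, ← Finset.sum_add_distrib]
  refine Finset.sum_congr rfl fun b _ => ?_
  rw [adjMat_symm_apply G, ← adjMat_splitVertex_add hW hdisj b, add_mul,
    adjMat_symm_apply _ (Sum.inr 0), adjMat_symm_apply _ (Sum.inr 1)]
  rfl

end splitVertex

theorem adjMat_mulVec_pos_of_adj {V : Type*} [Fintype V] {G : SimpleGraph V} {f : V → ℝ}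
    (hf : ∀ i, 0 < f i) {i j : V} (h : G.Adj i j) : 0 < (adjMat G *ᵥ f) i := by
  refine Finset.sum_pos' (fun k _ => mul_nonneg (adjMat_nonneg G i k) (hf k).le)
    ⟨j, Finset.mem_univ j, ?_⟩
  change 0 < adjMat G i j * f j
  rw [adjMat_of_adj h, one_mul]
  exact hf j

/-- **Simić's splitting theorem.**  Splitting a vertex `v` of a connected finite
simple graph according to a non-trivial bipartition `W₁ ∪ W₂` of its
neighbourhood strictly decreases the spectral radius. -/
theorem graphSpectralRadius_splitVertex_lt {V : Type*} [Fintype V] [DecidableEq V]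
    (G : SimpleGraph V) (hG : G.Connected)
    (v : V) (hv : 2 ≤ deg G v) (W₁ W₂ : Set V)
    (hW : W₁ ∪ W₂ = G.neighborSet v) (hdisj : Disjoint W₁ W₂)
    (h₁ : W₁.Nonempty) (h₂ : W₂.Nonempty) :
    graphSpectralRadius (splitVertex G v W₁ W₂) < graphSpectralRadius G := by
  obtain ⟨z, hz, hAz⟩ := hG.exists_pos_adjMat_mulVec
  set ρ := graphSpectralRadius G
  set B := adjMat (splitVertex G v W₁ W₂) with hB
  have hBsymm : ∀ p q, B p q = B q p := adjMat_symm_apply _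
  have hzpos : ∀ p, 0 < (z ∘ unsplit v) p := fun p => hz _
  have hne : ∀ w ∈ W₁ ∪ W₂, w ≠ v := by
    intro w hw
    rw [hW] at hw
    exact (G.ne_of_adj hw).symm
  obtain ⟨w₁, hw₁⟩ := h₁
  obtain ⟨w₂, hw₂⟩ := h₂
  have hpos₀ : 0 < (B *ᵥ (z ∘ unsplit v)) (Sum.inr 0) :=
    adjMat_mulVec_pos_of_adj hzpos
      ((splitVertex_adj_inl_zero ⟨w₁, hne w₁ (Or.inl hw₁)⟩).mpr hw₁).symm
  have hpos₁ : 0 < (B *ᵥ (z ∘ unsplit v)) (Sum.inr 1) :=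
    adjMat_mulVec_pos_of_adj hzpos
      ((splitVertex_adj_inl_one ⟨w₂, hne w₂ (Or.inr hw₂)⟩).mpr hw₂).symm
  have hsum := adjMat_splitVertex_mulVec_inr_add hW hdisj z
  have hinl : ∀ a, (B *ᵥ (z ∘ unsplit v)) (Sum.inl a) = ρ * z a.1 := fun a => by
    rw [hB, adjMat_splitVertex_mulVec_inl hW hdisj, hAz]
    rfl
  rw [hAz, Pi.smul_apply, smul_eq_mul, ← hB] at hsum
  have hinr : ∀ i, (B *ᵥ (z ∘ unsplit v)) (Sum.inr i) < ρ * z v := by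
    intro i
    fin_cases i
    · simp only [Fin.zero_eta]; linarith
    · simp only [Fin.mk_one]; linarith
  have hle : ∀ p, (B *ᵥ (z ∘ unsplit v)) p ≤ ρ * (z ∘ unsplit v) p := by
    rintro (a | i)
    · exact (hinl a).le
    · exact (hinr i).le
  have : Nonempty ({w : V // w ≠ v} ⊕ Fin 2) := ⟨Sum.inr 0⟩
  refine ((finite_setOf_hasEigenvalue B).csSup_lt_iff
    (isHermitian_adjMat _).nonempty_setOf_hasEigenvalue).mpr fun μ hμ => ?_
  obtain ⟨x, hx0, hx⟩ := hasEigenvalue_toLin'_iff.mp hμ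
  by_contra! hρμ
  set y : {w : V // w ≠ v} ⊕ Fin 2 → ℝ := fun p => |x p| with hy
  have hy0 : ∀ p, 0 ≤ y p := fun p => abs_nonneg _
  have hsub : ∀ p, μ * y p ≤ (B *ᵥ y) p := smul_abs_le_mulVec_abs (adjMat_nonneg _) hx
  have hadj : ∑ p, (B *ᵥ y) p * (z ∘ unsplit v) p = ∑ p, y p * (B *ᵥ (z ∘ unsplit v)) p := by
    simp only [Matrix.mulVec, dotProduct, Finset.sum_mul, Finset.mul_sum]
    rw [Finset.sum_comm]
    refine Finset.sum_congr rfl fun p _ => Finset.sum_congr rfl fun q _ => ?_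
    rw [hBsymm q p]
    ring
  have hgap₁ : ∀ p, 0 ≤ ((B *ᵥ y) p - μ * y p) * (z ∘ unsplit v) p := fun p =>
    mul_nonneg (sub_nonneg.mpr (hsub p)) (hzpos p).le
  have hgap₂ : ∀ p, 0 ≤ y p * (μ * (z ∘ unsplit v) p - (B *ᵥ (z ∘ unsplit v)) p) := fun p =>
    mul_nonneg (hy0 p) (sub_nonneg.mpr ((hle p).trans
      (mul_le_mul_of_nonneg_right hρμ (hzpos p).le)))
  have htotal : ∑ p, (((B *ᵥ y) p - μ * y p) * (z ∘ unsplit v) p +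
      y p * (μ * (z ∘ unsplit v) p - (B *ᵥ (z ∘ unsplit v)) p)) = 0 := by
    rw [← sub_eq_zero.mpr hadj, ← Finset.sum_sub_distrib]
    exact Finset.sum_congr rfl fun p _ => by ring
  rw [Finset.sum_eq_zero_iff_of_nonneg fun p _ => add_nonneg (hgap₁ p) (hgap₂ p)] at htotal
  have hBy : ∀ p, (B *ᵥ y) p = μ * y p := fun p => by
    have := htotal p (Finset.mem_univ p)
    have h0 : ((B *ᵥ y) p - μ * y p) * (z ∘ unsplit v) p = 0 := by
      linarith [hgap₁ p, hgap₂ p]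
    exact sub_eq_zero.mp ((mul_eq_zero.mp h0).resolve_right (hzpos p).ne')
  have hyr : ∀ i, y (Sum.inr i) = 0 := fun i => by
    have := htotal (Sum.inr i) (Finset.mem_univ _)
    have h0 := le_antisymm (by linarith [hgap₁ (Sum.inr i)]) (hgap₂ (Sum.inr i))
    refine (mul_eq_zero.mp h0).resolve_right (sub_pos.mpr ((hinr i).trans_le ?_)).ne'
    exact mul_le_mul_of_nonneg_right hρμ (hz v).le
  let u : V → ℝ := fun w => if h : w = v then 0 else y (Sum.inl ⟨w, h⟩)
  have huv : u v = 0 := dif_pos rfl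
  have hul : ∀ a : {w : V // w ≠ v}, u a.1 = y (Sum.inl a) := fun a => dif_neg a.2
  have huy : u ∘ unsplit v = y := by
    funext p
    rcases p with a | i
    · exact hul a
    · exact huv.trans (hyr i).symm
  have hu0 : ∀ w, 0 ≤ u w := fun w => by
    by_cases h : w = v
    · rw [h, huv]
    · exact (hul ⟨w, h⟩).symm ▸ hy0 _
  have hAu : adjMat G *ᵥ u = μ • u := by
    funext w
    rw [Pi.smul_apply, smul_eq_mul]
    by_cases h : w = v
    · rw [h, ← adjMat_splitVertex_mulVec_inr_add hW hdisj, huy, ← hB, hBy, hBy, hyr, hyr, huv]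
      ring
    · have := adjMat_splitVertex_mulVec_inl hW hdisj u ⟨w, h⟩
      rw [huy, ← hB, hBy, ← hul] at this
      exact this.symm
  have hu := hG.eq_zero_of_adjMat_mulVec hu0 hAu huv
  refine hx0 (funext fun p => abs_eq_zero.mp ?_)
  change y p = 0
  rw [← huy, hu]
  rfl
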